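/- Let (S,d) be a complete separable metric space and let T̂, T : S → P(S) be Markov kernels (Borel-measurable maps into Borel probability measures on S) such that W(T̂(s), T(s)) ≤ Δ for every s ∈ S, where Δ ≥ 0. Then for every Borel probability measure μ on S, W(μ.bind T̂, μ.bind T) ≤ Δ, where μ.bind T denotes the measure A ↦ ∫ T(s)(A) dμ(s). (Base case δ(1) ≤ Δ in the proof of Theorem 1.) -/

import Mathlib

open MeasureTheory
open scoped NNReal ENNReal

/-- The (1st) Wasserstein distance between two Borel probability measures on a metric
space: the infimum over all couplings `π` of `μ` and `ν` of `∫ d(x,y) dπ`. -/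
noncomputable def wassersteinDist {S : Type*} [MetricSpace S] [MeasurableSpace S]
    (μ ν : Measure S) : ℝ :=
  sInf {c : ℝ | ∃ π : Measure (S × S), IsProbabilityMeasure π ∧
    π.map Prod.fst = μ ∧ π.map Prod.snd = ν ∧ c = ∫ p, dist p.1 p.2 ∂π}

open ProbabilityTheory Filter Topology

/-- A measure on `X × Y` whose marginals are `μ` and `ν`. -/
structure IsCoupling {X Y : Type*} [MeasurableSpace X] [MeasurableSpace Y]
    (π : Measure (X × Y)) (μ : Measure X) (ν : Measure Y) : Prop where
  map_fst : π.map Prod.fst = μ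
  map_snd : π.map Prod.snd = ν

namespace IsCoupling

variable {X Y : Type*} [MeasurableSpace X] [MeasurableSpace Y]
  {π : Measure (X × Y)} {μ : Measure X} {ν : Measure Y}

lemma isProbabilityMeasure (h : IsCoupling π μ ν) [IsProbabilityMeasure μ] :
    IsProbabilityMeasure π := by
  constructor
  rw [← Set.preimage_univ (f := Prod.fst), ← Measure.map_apply measurable_fst .univ, h.map_fst,
    measure_univ]

lemma lintegral_fst (h : IsCoupling π μ ν) {f : X → ℝ≥0∞} (hf : Measurable f) :
    ∫⁻ p, f p.1 ∂π = ∫⁻ x, f x ∂μ := by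
  rw [← h.map_fst, lintegral_map hf measurable_fst]

lemma lintegral_snd (h : IsCoupling π μ ν) {f : Y → ℝ≥0∞} (hf : Measurable f) :
    ∫⁻ p, f p.2 ∂π = ∫⁻ y, f y ∂ν := by
  rw [← h.map_snd, lintegral_map hf measurable_snd]

lemma map {X' Y' : Type*} [MeasurableSpace X'] [MeasurableSpace Y'] (h : IsCoupling π μ ν)
    {f : X → X'} {g : Y → Y'} (hf : Measurable f) (hg : Measurable g) :
    IsCoupling (π.map (Prod.map f g)) (μ.map f) (ν.map g) := by
  constructor
  · rw [Measure.map_map measurable_fst (hf.prodMap hg), ← h.map_fst,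
      Measure.map_map hf measurable_fst]
    rfl
  · rw [Measure.map_map measurable_snd (hf.prodMap hg), ← h.map_snd,
      Measure.map_map hg measurable_snd]
    rfl

lemma prod [IsProbabilityMeasure μ] [IsProbabilityMeasure ν] :
    IsCoupling (μ.prod ν) μ ν := ⟨by simp, by simp⟩

end IsCoupling

lemma exists_lift_fst {X I Y : Type*} [MeasurableSpace X] [MeasurableSpace I] [MeasurableSpace Y]
    [StandardBorelSpace Y] [Nonempty Y] (μ : Measure X) [SFinite μ] {k : X → I}
    (hk : Measurable k) (γ : Measure (I × Y)) [IsFiniteMeasure γ]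
    (h : γ.map Prod.fst = μ.map k) :
    ∃ ρ : Measure (X × Y), ρ.map Prod.fst = μ ∧ ρ.map (Prod.map k id) = γ := by
  refine ⟨μ ⊗ₘ (γ.condKernel.comap k hk), Measure.fst_compProd _ _, ?_⟩
  ext s hs
  have hγ : γ = (μ.map k) ⊗ₘ γ.condKernel := by
    rw [← h]; exact (γ.disintegrate γ.condKernel).symm
  conv_rhs => rw [hγ]
  rw [Measure.map_apply (hk.prodMap measurable_id) hs,
    Measure.compProd_apply (hk.prodMap measurable_id hs), Measure.compProd_apply hs,
    lintegral_map (Kernel.measurable_kernel_prodMk_left hs) hk]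
  rfl

/-- Couplings of images lift to couplings of the original measures. -/
lemma IsCoupling.exists_lift {X I Y J : Type*} [MeasurableSpace X] [MeasurableSpace I]
    [MeasurableSpace Y] [MeasurableSpace J] [StandardBorelSpace X] [Nonempty X]
    [StandardBorelSpace J] [Nonempty J]
    {μ : Measure X} [IsProbabilityMeasure μ] {ν : Measure Y} [IsProbabilityMeasure ν]
    {k : X → I} (hk : Measurable k) {l : Y → J} (hl : Measurable l)
    {γ : Measure (I × J)} (h : IsCoupling γ (μ.map k) (ν.map l)) :
    ∃ π : Measure (X × Y), IsCoupling π μ ν ∧ π.map (Prod.map k l) = γ := by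
  have := Measure.isProbabilityMeasure_map (μ := μ) hk.aemeasurable
  have := h.isProbabilityMeasure
  obtain ⟨ρ, hρ, hργ⟩ := exists_lift_fst μ hk γ h.map_fst
  have hρ2 : IsCoupling ρ μ (ν.map l) := by
    refine ⟨hρ, ?_⟩
    rw [← h.map_snd, ← hργ, Measure.map_map measurable_snd (hk.prodMap measurable_id)]
    rfl
  have := hρ2.isProbabilityMeasure
  have := Measure.isProbabilityMeasure_map (μ := ρ) measurable_swap.aemeasurable
  obtain ⟨σ, hσ, hσρ⟩ := exists_lift_fst ν hl (ρ.map Prod.swap) (by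
    rw [Measure.map_map measurable_fst measurable_swap]; exact hρ2.map_snd)
  have hσρ' : (σ.map Prod.swap).map (Prod.map id l) = ρ := by
    rw [Measure.map_map (measurable_id.prodMap hl) measurable_swap]
    have : (Prod.map id l ∘ Prod.swap : Y × X → X × J) = Prod.swap ∘ Prod.map l id := rfl
    rw [this, ← Measure.map_map measurable_swap (hl.prodMap measurable_id), hσρ,
      Measure.map_map measurable_swap measurable_swap]
    simp
  refine ⟨σ.map Prod.swap, ⟨?_, ?_⟩, ?_⟩
  · rw [← hρ]
    conv_rhs => rw [← hσρ', Measure.map_map measurable_fst (measurable_id.prodMap hl)]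
    rfl
  · rw [Measure.map_map measurable_snd measurable_swap]
    exact hσ
  · rw [← hργ, ← hσρ', Measure.map_map (hk.prodMap measurable_id) (measurable_id.prodMap hl)]
    rfl

section Finite

open scoped Pointwise

variable {ι : Type*} [Fintype ι]

/-- The marginals and the cost of a matrix. -/
noncomputable def marginalsCost (c : ι × ι → ℝ) :
    (ι × ι → ℝ) →ₗ[ℝ] (ι → ℝ) × (ι → ℝ) × ℝ where
  toFun w := (fun i => ∑ j, w (i, j), fun j => ∑ i, w (i, j), ∑ z, c z * w z)
  map_add' v w := by
    ext <;> simp [Finset.sum_add_distrib, mul_add]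
  map_smul' a w := by
    ext <;> simp [Finset.mul_sum, mul_left_comm]

/-- Marginals of couplings of cost at most the third coordinate. -/
def couplingSet (c : ι × ι → ℝ) : Set ((ι → ℝ) × (ι → ℝ) × ℝ) :=
  marginalsCost c '' stdSimplex ℝ (ι × ι) + {0} ×ˢ {0} ×ˢ Set.Ici 0

lemma convex_couplingSet (c : ι × ι → ℝ) : Convex ℝ (couplingSet c) :=
  ((convex_stdSimplex ℝ _).linear_image _).add
    ((convex_singleton _).prod ((convex_singleton _).prod (convex_Ici _)))

lemma isClosed_couplingSet (c : ι × ι → ℝ) : IsClosed (couplingSet c) := by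
  refine IsClosed.add_left_of_isCompact ?_ ?_
  · exact isClosed_singleton.prod (isClosed_singleton.prod isClosed_Ici)
  · exact (isCompact_stdSimplex ℝ _).image (LinearMap.continuous_of_finiteDimensional _)

variable [MeasurableSpace ι] [MeasurableSingletonClass ι]

lemma measureReal_map_fst_singleton (γ : Measure (ι × ι)) [IsFiniteMeasure γ] (i : ι) :
    (γ.map Prod.fst).real {i} = ∑ j, γ.real {(i, j)} := by
  classical
  rw [map_measureReal_apply measurable_fst (measurableSet_singleton i)]
  have : Prod.fst ⁻¹' {i} = ((Finset.univ.image (fun j : ι => (i, j)) : Finset (ι × ι)) :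
      Set (ι × ι)) := by
    ext ⟨a, b⟩; simp [eq_comm]
  rw [this, ← sum_measureReal_singleton, Finset.sum_image (by simp [Function.Injective])]

lemma measureReal_map_snd_singleton (γ : Measure (ι × ι)) [IsFiniteMeasure γ] (j : ι) :
    (γ.map Prod.snd).real {j} = ∑ i, γ.real {(i, j)} := by
  classical
  rw [map_measureReal_apply measurable_snd (measurableSet_singleton j)]
  have : Prod.snd ⁻¹' {j} = ((Finset.univ.image (fun i : ι => (i, j)) : Finset (ι × ι)) :
      Set (ι × ι)) := by
    ext ⟨a, b⟩; simp [eq_comm]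
  rw [this, ← sum_measureReal_singleton, Finset.sum_image (by simp [Function.Injective])]

lemma IsCoupling.mem_couplingSet {c : ι × ι → ℝ} {γ : Measure (ι × ι)} {p q : Measure ι}
    [IsProbabilityMeasure p] (h : IsCoupling γ p q) {e : ℝ} (he : ∫ z, c z ∂γ ≤ e) :
    ((fun i => p.real {i}, fun j => q.real {j}, e) : (ι → ℝ) × (ι → ℝ) × ℝ) ∈ couplingSet c := by
  have := h.isProbabilityMeasure
  refine ⟨_, ⟨fun z => γ.real {z}, ⟨fun z => measureReal_nonneg, ?_⟩, rfl⟩,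
    (0, 0, e - ∫ z, c z ∂γ), ⟨rfl, rfl, sub_nonneg.2 he⟩, ?_⟩
  · rw [sum_measureReal_singleton]; simp
  · rw [integral_fintype .of_finite]
    simp only [marginalsCost, LinearMap.coe_mk, AddHom.coe_mk, Prod.mk_add_mk, add_zero,
      smul_eq_mul, ← measureReal_map_fst_singleton, ← measureReal_map_snd_singleton, h.map_fst,
      h.map_snd, mul_comm, add_sub_cancel]

lemma exists_isCoupling_of_mem_couplingSet {c : ι × ι → ℝ} {p q : Measure ι}
    [IsFiniteMeasure p] [IsFiniteMeasure q] {e : ℝ}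
    (h : ((fun i => p.real {i}, fun j => q.real {j}, e) : (ι → ℝ) × (ι → ℝ) × ℝ) ∈
      couplingSet c) :
    ∃ γ : Measure (ι × ι), IsCoupling γ p q ∧ ∫ z, c z ∂γ ≤ e := by
  classical
  obtain ⟨_, ⟨w, ⟨hw, -⟩, rfl⟩, ⟨_, _, t⟩, ⟨rfl, rfl, ht⟩, h⟩ := h
  simp only [marginalsCost, LinearMap.coe_mk, AddHom.coe_mk, Prod.mk_add_mk, add_zero,
    Prod.mk.injEq] at h
  obtain ⟨h1, h2, h3⟩ := h
  let γ : Measure (ι × ι) := ∑ z, ENNReal.ofReal (w z) • Measure.dirac z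
  have hγ (z : ι × ι) : γ {z} = ENNReal.ofReal (w z) := by
    simp [γ, Set.indicator_apply]
  have : IsFiniteMeasure γ := ⟨by simp [γ, ENNReal.sum_lt_top]⟩
  have hγ' (z : ι × ι) : γ.real {z} = w z := by
    rw [measureReal_def, hγ, ENNReal.toReal_ofReal (hw z)]
  refine ⟨γ, ⟨?_, ?_⟩, ?_⟩
  · refine Measure.ext_of_singleton fun i => ?_
    rw [← measureReal_eq_measureReal_iff, measureReal_map_fst_singleton]
    simpa only [hγ'] using congrFun h1 i
  · refine Measure.ext_of_singleton fun i => ?_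
    rw [← measureReal_eq_measureReal_iff, measureReal_map_snd_singleton]
    simpa only [hγ'] using congrFun h2 i
  · rw [integral_fintype .of_finite, ← h3]
    rw [Set.mem_Ici] at ht
    simpa only [hγ', smul_eq_mul, mul_comm, le_add_iff_nonneg_right] using ht

lemma integral_measureReal_eq_bind {Ω Y : Type*} [MeasurableSpace Ω] [MeasurableSpace Y]
    {μ : Measure Ω} {p : Ω → Measure Y} (hp : Measurable p)
    [∀ s, IsProbabilityMeasure (p s)] {A : Set Y} (hA : MeasurableSet A) :
    ∫ s, (p s).real A ∂μ = (μ.bind p).real A := by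
  rw [measureReal_def, Measure.bind_apply hA hp.aemeasurable]
  exact integral_toReal ((Measure.measurable_coe hA).comp hp).aemeasurable (by simp)

lemma integrable_measureReal {Ω Y : Type*} [MeasurableSpace Ω] [MeasurableSpace Y]
    {μ : Measure Ω} [IsFiniteMeasure μ] {p : Ω → Measure Y} (hp : Measurable p)
    [∀ s, IsProbabilityMeasure (p s)] {A : Set Y} (hA : MeasurableSet A) :
    Integrable (fun s => (p s).real A) μ := by
  refine Integrable.of_bound (C := 1)
    ((Measure.measurable_coe hA).comp hp).ennreal_toReal.aestronglyMeasurable ?_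
  exact .of_forall fun s => by
    rw [Real.norm_of_nonneg measureReal_nonneg]; exact measureReal_le_one

lemma exists_isCoupling_bind_of_fintype {Ω : Type*} [MeasurableSpace Ω] {μ : Measure Ω}
    [IsProbabilityMeasure μ] {p q : Ω → Measure ι} (hp : Measurable p) (hq : Measurable q)
    [∀ s, IsProbabilityMeasure (p s)] [∀ s, IsProbabilityMeasure (q s)]
    {c : ι × ι → ℝ} {e : Ω → ℝ} (he : Integrable e μ)
    (h : ∀ᵐ s ∂μ, ∃ γ, IsCoupling γ (p s) (q s) ∧ ∫ z, c z ∂γ ≤ e s) :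
    ∃ γ, IsCoupling γ (μ.bind p) (μ.bind q) ∧ ∫ z, c z ∂γ ≤ ∫ s, e s ∂μ := by
  have := isProbabilityMeasure_bind hp.aemeasurable (.of_forall fun s => inferInstance)
    (m := μ)
  have := isProbabilityMeasure_bind hq.aemeasurable (.of_forall fun s => inferInstance)
    (m := μ)
  apply exists_isCoupling_of_mem_couplingSet
  have hpi (i : ι) := integrable_measureReal hp (measurableSet_singleton i) (μ := μ)
  have hqi (i : ι) := integrable_measureReal hq (measurableSet_singleton i) (μ := μ)
  have hp' := Integrable.of_eval hpi
  have hq' := Integrable.of_eval hqi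
  have key := (convex_couplingSet c).integral_mem (isClosed_couplingSet c)
    (f := fun s => (fun i => (p s).real {i}, fun j => (q s).real {j}, e s))
    (h.mono fun s ⟨γ, hγ, hc⟩ => hγ.mem_couplingSet hc) (hp'.prodMk (hq'.prodMk he))
  rw [integral_pair hp' (hq'.prodMk he), integral_pair hq' he] at key
  convert! key using 2
  · ext i
    rw [eval_integral hpi, integral_measureReal_eq_bind hp (measurableSet_singleton i)]
  · congr 1
    ext i
    rw [eval_integral hqi, integral_measureReal_eq_bind hq (measurableSet_singleton i)]

end Finite

lemma bind_map {Ω X Y : Type*} [MeasurableSpace Ω] [MeasurableSpace X] [MeasurableSpace Y]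
    {μ : Measure Ω} {p : Ω → Measure X} (hp : Measurable p) {k : X → Y} (hk : Measurable k) :
    μ.bind (fun s => (p s).map k) = (μ.bind p).map k := by
  have hkp : Measurable fun s => (p s).map k := (Measure.measurable_map k hk).comp hp
  ext A hA
  rw [Measure.bind_apply hA hkp.aemeasurable, Measure.map_apply hk hA,
    Measure.bind_apply (hk hA) hp.aemeasurable]
  simp only [Measure.map_apply hk hA]

section Metric

variable {S : Type*} [MetricSpace S] [TopologicalSpace.SeparableSpace S] [MeasurableSpace S]
  [BorelSpace S] {α β : Measure S} {π : Measure (S × S)}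

lemma IsCoupling.lintegral_edist_map_le (h : IsCoupling π α β) {r : S → S} (hr : Measurable r) :
    ∫⁻ z, edist (r z.1) (r z.2) ∂π ≤
      ∫⁻ z, edist z.1 z.2 ∂π + ∫⁻ x, edist x (r x) ∂α + ∫⁻ y, edist y (r y) ∂β := by
  have := UniformSpace.secondCountable_of_separable S
  have hm : Measurable fun x => edist x (r x) := measurable_id.edist hr
  rw [← h.lintegral_fst hm, ← h.lintegral_snd hm, ← lintegral_add_left (by fun_prop),
    ← lintegral_add_left (by fun_prop)]
  refine lintegral_mono fun z => (edist_triangle4 _ z.1 z.2 _).trans_eq ?_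
  rw [edist_comm (r z.1), add_comm (edist z.1 (r z.1))]

lemma IsCoupling.lintegral_edist_le_map (h : IsCoupling π α β) {r : S → S} (hr : Measurable r) :
    ∫⁻ z, edist z.1 z.2 ∂π ≤
      ∫⁻ z, edist (r z.1) (r z.2) ∂π + ∫⁻ x, edist x (r x) ∂α + ∫⁻ y, edist y (r y) ∂β := by
  have := UniformSpace.secondCountable_of_separable S
  have hm : Measurable fun x => edist x (r x) := measurable_id.edist hr
  rw [← h.lintegral_fst hm, ← h.lintegral_snd hm, ← lintegral_add_left (by fun_prop),
    ← lintegral_add_left (by fun_prop)]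
  refine lintegral_mono fun z => (edist_triangle4 _ (r z.1) (r z.2) _).trans_eq ?_
  rw [edist_comm (r z.2), add_comm (edist z.1 (r z.1))]

/-- A measure with finite first moment is close to a finitely supported image of itself. -/
lemma exists_simpleFunc_lintegral_edist_lt {x₀ : S} (h : ∫⁻ x, edist x₀ x ∂α ≠ ∞)
    {ε : ℝ≥0∞} (hε : 0 < ε) : ∃ r : SimpleFunc S S, ∫⁻ x, edist x (r x) ∂α < ε := by
  have := UniformSpace.secondCountable_of_separable S
  let r := SimpleFunc.approxOn id measurable_id Set.univ x₀ (Set.mem_univ _)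
  have hr : Tendsto (fun n => ∫⁻ x, edist x (r n x) ∂α) atTop (𝓝 (∫⁻ _, 0 ∂α)) := by
    refine tendsto_lintegral_of_dominated_convergence (fun x => edist x₀ x)
      (fun n => measurable_id.edist (r n).measurable) (fun n => .of_forall fun x => ?_) h
      (.of_forall fun x => ?_)
    · beta_reduce
      rw [edist_comm x]
      exact SimpleFunc.edist_approxOn_le measurable_id (Set.mem_univ _) x n
    · have := SimpleFunc.tendsto_approxOn measurable_id (Set.mem_univ x₀)
        (x := x) (by simp)
      simpa using (tendsto_const_nhds (x := x)).edist this
  rw [lintegral_zero] at hr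
  obtain ⟨n, hn⟩ := (hr.eventually_lt_const hε).exists
  exact ⟨r n, hn⟩

variable [CompleteSpace S]

lemma exists_isCoupling_bind_lintegral_edist_le {Ω : Type*} [MeasurableSpace Ω] {μ : Measure Ω}
    [IsProbabilityMeasure μ] {p q : Ω → Measure S} (hp : Measurable p) (hq : Measurable q)
    [∀ s, IsProbabilityMeasure (p s)] [∀ s, IsProbabilityMeasure (q s)] {c : ℝ≥0∞} (hc : c ≠ ∞)
    (h : ∀ᵐ s ∂μ, ∃ π, IsCoupling π (p s) (q s) ∧ ∫⁻ z, edist z.1 z.2 ∂π ≤ c)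
    (r : SimpleFunc S S) (hrp : ∫⁻ x, edist x (r x) ∂(μ.bind p) ≠ ∞)
    (hrq : ∫⁻ x, edist x (r x) ∂(μ.bind q) ≠ ∞) :
    ∃ π, IsCoupling π (μ.bind p) (μ.bind q) ∧ ∫⁻ z, edist z.1 z.2 ∂π ≤
      c + 2 * (∫⁻ x, edist x (r x) ∂(μ.bind p) + ∫⁻ x, edist x (r x) ∂(μ.bind q)) := by
  have := UniformSpace.secondCountable_of_separable S
  have := isProbabilityMeasure_bind hp.aemeasurable (.of_forall fun s => inferInstance) (m := μ)
  have := isProbabilityMeasure_bind hq.aemeasurable (.of_forall fun s => inferInstance) (m := μ)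
  have : Nonempty S := (μ.bind p).nonempty_of_neZero
  let k : S → r.range := fun x => ⟨r x, r.mem_range_self x⟩
  have hk : Measurable k := r.measurable.subtype_mk
  have : Nonempty r.range := Nonempty.map k inferInstance
  have hm : Measurable fun x => edist x (r x) := measurable_id.edist r.measurable
  rw [Measure.lintegral_bind hp.aemeasurable hm.aemeasurable] at hrp ⊢
  rw [Measure.lintegral_bind hq.aemeasurable hm.aemeasurable] at hrq ⊢
  let e : Ω → ℝ≥0∞ := fun s => c + ∫⁻ x, edist x (r x) ∂(p s) + ∫⁻ x, edist x (r x) ∂(q s)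
  have hmp : Measurable fun s => ∫⁻ x, edist x (r x) ∂(p s) :=
    (Measure.measurable_lintegral hm).comp hp
  have hmq : Measurable fun s => ∫⁻ x, edist x (r x) ∂(q s) :=
    (Measure.measurable_lintegral hm).comp hq
  have he : Measurable e := (measurable_const.add hmp).add hmq
  have hei : ∫⁻ s, e s ∂μ = c + ∫⁻ s, ∫⁻ x, edist x (r x) ∂(p s) ∂μ +
      ∫⁻ s, ∫⁻ x, edist x (r x) ∂(q s) ∂μ := by
    rw [lintegral_add_right _ hmq, lintegral_add_right _ hmp]
    simp
  have hef : ∫⁻ s, e s ∂μ ≠ ∞ := by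
    rw [hei]; simp [hc, hrp, hrq]
  have hefs := ae_lt_top he hef
  have hcost (γ : Measure (r.range × r.range)) : ∫ z, dist z.1 z.2 ∂γ =
      (∫⁻ z, edist z.1 z.2 ∂γ).toReal := by
    rw [integral_eq_lintegral_of_nonneg_ae (.of_forall fun _ => dist_nonneg)
      (measurable_of_finite _).aestronglyMeasurable]
    simp only [edist_dist]
  have hpk (s : Ω) : IsProbabilityMeasure ((p s).map k) :=
    Measure.isProbabilityMeasure_map hk.aemeasurable
  have hqk (s : Ω) : IsProbabilityMeasure ((q s).map k) :=
    Measure.isProbabilityMeasure_map hk.aemeasurable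
  have hedist : Measurable fun z : r.range × r.range => edist z.1 z.2 := measurable_of_finite _
  have hmap (π : Measure (S × S)) : ∫⁻ z, edist z.1 z.2 ∂(π.map (Prod.map k k)) =
      ∫⁻ z, edist (r z.1) (r z.2) ∂π := by
    rw [lintegral_map hedist (hk.prodMap hk)]
    rfl
  obtain ⟨γ, hγ, hγc⟩ := exists_isCoupling_bind_of_fintype (μ := μ)
    (c := fun z => dist z.1 z.2) (e := fun s => (e s).toReal)
    (p := fun s => (p s).map k) (q := fun s => (q s).map k)
    ((Measure.measurable_map k hk).comp hp) ((Measure.measurable_map k hk).comp hq)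
    (integrable_toReal_of_lintegral_ne_top he.aemeasurable hef) (by
      filter_upwards [h, hefs] with s ⟨π, hπ, hπc⟩ hes
      refine ⟨_, hπ.map hk hk, ?_⟩
      rw [hcost, hmap]
      refine ENNReal.toReal_mono hes.ne ((hπ.lintegral_edist_map_le r.measurable).trans ?_)
      exact add_le_add_left (add_le_add_left hπc _) _)
  rw [bind_map hp hk, bind_map hq hk] at hγ
  obtain ⟨π, hπ, hπγ⟩ := hγ.exists_lift hk hk
  refine ⟨π, hπ, (hπ.lintegral_edist_le_map r.measurable).trans ?_⟩
  have := Measure.isProbabilityMeasure_map (μ := μ.bind p) hk.aemeasurable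
  have := hγ.isProbabilityMeasure
  rw [← hmap, hπγ, Measure.lintegral_bind hp.aemeasurable hm.aemeasurable,
    Measure.lintegral_bind hq.aemeasurable hm.aemeasurable]
  have hγc' : ∫⁻ z, edist z.1 z.2 ∂γ ≤ ∫⁻ s, e s ∂μ := by
    rw [hcost, integral_toReal he.aemeasurable hefs] at hγc
    refine (ENNReal.toReal_le_toReal ?_ hef).1 hγc
    rw [lintegral_fintype]
    simp [ENNReal.mul_eq_top, edist_ne_top]
  rw [hei] at hγc'
  refine (add_le_add_left (add_le_add_left hγc' _) _).trans_eq ?_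
  ring

end Metric

section Wasserstein

variable {S : Type*} [MetricSpace S] [MeasurableSpace S] {μ ν : Measure S}

lemma wassersteinDist_le [IsProbabilityMeasure μ] {π : Measure (S × S)}
    (h : IsCoupling π μ ν) : wassersteinDist μ ν ≤ ∫ z, dist z.1 z.2 ∂π := by
  refine csInf_le ⟨0, ?_⟩ ⟨π, h.isProbabilityMeasure, h.map_fst, h.map_snd, rfl⟩
  rintro _ ⟨π, -, -, -, rfl⟩
  exact integral_nonneg fun _ => dist_nonneg

lemma exists_isCoupling_integral_lt [IsProbabilityMeasure μ] [IsProbabilityMeasure ν] {c : ℝ}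
    (h : wassersteinDist μ ν < c) : ∃ π, IsCoupling π μ ν ∧ ∫ z, dist z.1 z.2 ∂π < c := by
  unfold wassersteinDist at h
  obtain ⟨_, ⟨π, -, h1, h2, rfl⟩, hc⟩ := exists_lt_of_csInf_lt (by exact
    ⟨_, μ.prod ν, inferInstance, IsCoupling.prod.map_fst, IsCoupling.prod.map_snd, rfl⟩) h
  exact ⟨π, ⟨h1, h2⟩, hc⟩

variable [TopologicalSpace.SeparableSpace S] [BorelSpace S]

lemma integral_dist_eq_toReal (π : Measure (S × S)) :
    ∫ z, dist z.1 z.2 ∂π = (∫⁻ z, edist z.1 z.2 ∂π).toReal := by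
  have := UniformSpace.secondCountable_of_separable S
  rw [integral_eq_lintegral_of_nonneg_ae (.of_forall fun _ => dist_nonneg)
    (measurable_fst.dist measurable_snd).aestronglyMeasurable]
  simp only [edist_dist]

/-- Without finite first moments the product coupling has no integrable cost, so the Bochner
integral, and with it `wassersteinDist`, vanishes. -/
lemma wassersteinDist_nonpos_of_lintegral_eq_top [IsProbabilityMeasure μ] [IsProbabilityMeasure ν]
    (x₀ : S) (h : ∫⁻ x, edist x₀ x ∂μ = ∞ ∨ ∫⁻ x, edist x₀ x ∂ν = ∞) :
    wassersteinDist μ ν ≤ 0 := by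
  have := UniformSpace.secondCountable_of_separable S
  refine (wassersteinDist_le IsCoupling.prod).trans_eq ?_
  have hm : Measurable fun x => edist x₀ x := measurable_const.edist measurable_id
  have key {κ : Measure S} [IsProbabilityMeasure κ] (hκ : ∫⁻ x, edist x₀ x ∂κ = ∞) (y : S) :
      ∫⁻ x, edist x y ∂κ = ∞ := by
    by_contra hy
    have : ∫⁻ x, edist x₀ x ∂κ ≤ edist x₀ y + ∫⁻ x, edist x y ∂κ := by
      calc _ ≤ ∫⁻ x, edist x₀ y + edist x y ∂κ :=
            lintegral_mono fun x => edist_triangle_right _ _ _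
        _ = _ := by rw [lintegral_add_left measurable_const]; simp
    rw [hκ, top_le_iff] at this
    simp [hy, edist_ne_top] at this
  rw [integral_dist_eq_toReal]
  suffices ∫⁻ z, edist z.1 z.2 ∂(μ.prod ν) = ∞ by simp [this]
  have hme : Measurable fun z : S × S => edist z.1 z.2 := measurable_fst.edist measurable_snd
  rcases h with h | h
  · rw [lintegral_prod_symm _ hme.aemeasurable]
    simp [key h]
  · rw [lintegral_prod _ hme.aemeasurable]
    have key' (x : S) : ∫⁻ y, edist x y ∂ν = ∞ := by
      simpa only [edist_comm x] using key h x
    simp [key']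

lemma IsCoupling.lintegral_edist_ne_top {π : Measure (S × S)} (hπ : IsCoupling π μ ν)
    {x₀ : S} (hμ : ∫⁻ x, edist x₀ x ∂μ ≠ ∞) (hν : ∫⁻ x, edist x₀ x ∂ν ≠ ∞) :
    ∫⁻ z, edist z.1 z.2 ∂π ≠ ∞ := by
  have := UniformSpace.secondCountable_of_separable S
  have hm : Measurable fun x => edist x₀ x := measurable_const.edist measurable_id
  refine ne_top_of_le_ne_top (ENNReal.add_ne_top.2 ⟨hμ, hν⟩) ?_
  rw [← hπ.lintegral_fst hm, ← hπ.lintegral_snd hm, ← lintegral_add_left (by fun_prop)]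
  exact lintegral_mono fun z => edist_triangle_left _ _ _

end Wasserstein

/-- **Base case of Theorem 1** (`δ(1) ≤ Δ`): if two Markov kernels are pointwise
`Δ`-close in Wasserstein distance, then for any start distribution `μ` the
one-step distributions `μ.bind T̂` and `μ.bind T` are `Δ`-close in Wasserstein
distance. -/
theorem wasserstein_bind_le_of_pointwise_le
    {S : Type*} [MetricSpace S] [CompleteSpace S] [TopologicalSpace.SeparableSpace S]
    [MeasurableSpace S] [BorelSpace S]
    (That T : S → Measure S)
    (hThatm : Measurable That) (hTm : Measurable T)
    (hThatp : ∀ s, IsProbabilityMeasure (That s)) (hTp : ∀ s, IsProbabilityMeasure (T s))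
    (Δ : ℝ) (hΔ : 0 ≤ Δ)
    (hacc : ∀ s, wassersteinDist (That s) (T s) ≤ Δ)
    (μ : Measure S) [IsProbabilityMeasure μ] :
    wassersteinDist (μ.bind That) (μ.bind T) ≤ Δ := by
  have := UniformSpace.secondCountable_of_separable S
  have := isProbabilityMeasure_bind hThatm.aemeasurable (.of_forall hThatp) (m := μ)
  have := isProbabilityMeasure_bind hTm.aemeasurable (.of_forall hTp) (m := μ)
  obtain ⟨x₀⟩ : Nonempty S := μ.nonempty_of_neZero
  by_cases h : ∫⁻ x, edist x₀ x ∂(μ.bind That) = ∞ ∨ ∫⁻ x, edist x₀ x ∂(μ.bind T) = ∞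
  · exact (wassersteinDist_nonpos_of_lintegral_eq_top x₀ h).trans hΔ
  obtain ⟨h1, h2⟩ := not_or.1 h
  have hm : Measurable fun x => edist x₀ x := measurable_const.edist measurable_id
  refine le_of_forall_pos_le_add fun ε hε => ?_
  obtain ⟨r, hr⟩ := exists_simpleFunc_lintegral_edist_lt (x₀ := x₀)
    (α := μ.bind That + μ.bind T) (by simp [lintegral_add_measure, h1, h2])
    (ENNReal.ofReal_pos.2 (by positivity : 0 < ε / 4))
  rw [lintegral_add_measure] at hr
  have hr' := ENNReal.add_ne_top.1 hr.ne_top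
  have hac : ∀ᵐ s ∂μ, ∃ π, IsCoupling π (That s) (T s) ∧
      ∫⁻ z, edist z.1 z.2 ∂π ≤ ENNReal.ofReal (Δ + ε / 2) := by
    rw [Measure.lintegral_bind hThatm.aemeasurable hm.aemeasurable] at h1
    rw [Measure.lintegral_bind hTm.aemeasurable hm.aemeasurable] at h2
    filter_upwards [ae_lt_top ((Measure.measurable_lintegral hm).comp hThatm) h1,
      ae_lt_top ((Measure.measurable_lintegral hm).comp hTm) h2] with s hs1 hs2
    obtain ⟨π, hπ, hc⟩ := exists_isCoupling_integral_lt
      ((hacc s).trans_lt (by linarith : Δ < Δ + ε / 2))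
    refine ⟨π, hπ, ?_⟩
    rw [integral_dist_eq_toReal] at hc
    exact (ENNReal.le_ofReal_iff_toReal_le (hπ.lintegral_edist_ne_top hs1.ne hs2.ne)
      (by positivity)).2 hc.le
  obtain ⟨π, hπ, hc⟩ := exists_isCoupling_bind_lintegral_edist_le hThatm hTm
    ENNReal.ofReal_ne_top hac r hr'.1 hr'.2
  refine (wassersteinDist_le hπ).trans ?_
  rw [integral_dist_eq_toReal]
  refine ENNReal.toReal_le_of_le_ofReal (by positivity) (hc.trans ?_)
  calc _ ≤ ENNReal.ofReal (Δ + ε / 2) + 2 * ENNReal.ofReal (ε / 4) := by gcongr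
    _ = ENNReal.ofReal (Δ + ε) := by
      rw [← ENNReal.ofReal_ofNat, ← ENNReal.ofReal_mul (by positivity),
        ← ENNReal.ofReal_add (by positivity) (by positivity)]
      congr 1
      ring
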